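/- arXiv:2203.11094 — 3 statements merged into one kernel-verified Lean document; each statement's English description precedes it below -/
import Mathlib

section
/- Let X be a scheme of finite type over ℂ and let m ∈ ℕ. Then the scheme of m-jets of X exists: there is a scheme J_m(X) of finite type over ℂ together with bijections Hom_{Spec ℂ}(Spec A, J_m(X)) ≅ Hom_{Spec ℂ}(Spec(A[t]/(t^{m+1})), X), natural in the commutative ℂ-algebra A. -/
open AlgebraicGeometry CategoryTheory

/-- The ℂ-algebra `A[t]/(t^(m+1))`. -/
abbrev JetAlg (A : Type) [CommRing A] (m : ℕ) : Type :=
  Polynomial A ⧸ Ideal.span {(Polynomial.X : Polynomial A) ^ (m + 1)}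

/-- The ring homomorphism `A[t]/(t^(m+1)) →+* B[t]/(t^(m+1))` induced by a ring
homomorphism `A →+* B` (sending `t` to `t`). -/
noncomputable def jetAlgMap {A B : Type} [CommRing A] [CommRing B] (m : ℕ)
    (φ : A →+* B) : JetAlg A m →+* JetAlg B m :=
  Ideal.Quotient.lift _ ((Ideal.Quotient.mk _).comp (Polynomial.mapRingHom φ))
    (fun q hq => by
      simp only [RingHom.comp_apply]
      refine Ideal.Quotient.eq_zero_iff_mem.mpr ?_
      rw [Ideal.mem_span_singleton] at hq ⊢
      obtain ⟨q', rfl⟩ := hq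
      exact ⟨Polynomial.map φ q', by
        simp [Polynomial.map_mul, Polynomial.map_pow, Polynomial.map_X]⟩)

/-- Morphisms `Spec A ⟶ Z` over `Spec ℂ`, for `A` a commutative ℂ-algebra and `Z` a
scheme equipped with a structure morphism `sZ : Z ⟶ Spec ℂ`. -/
def COver (A : Type) [CommRing A] [Algebra ℂ A] (Z : Scheme)
    (sZ : Z ⟶ Spec (CommRingCat.of ℂ)) : Type :=
  { f : Spec (CommRingCat.of A) ⟶ Z //
    f ≫ sZ = Spec.map (CommRingCat.ofHom (algebraMap ℂ A)) }

namespace JetAlg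

variable {A B : Type} [CommRing A] [CommRing B] {m : ℕ}

lemma jetAlgMap_mk (φ : A →+* B) (p : Polynomial A) :
    jetAlgMap m φ (Ideal.Quotient.mk _ p) = Ideal.Quotient.mk _ (p.map φ) := rfl

/-- The constants `A →+* A[t]/(t^(m+1))`. -/
noncomputable def const (A : Type) [CommRing A] (m : ℕ) : A →+* JetAlg A m :=
  (Ideal.Quotient.mk _).comp Polynomial.C

lemma jetAlgMap_comp_const (φ : A →+* B) :
    (jetAlgMap m φ).comp (const A m) = (const B m).comp φ := by
  ext a
  simp [const, jetAlgMap_mk]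

lemma jetAlgMap_comp {C : Type} [CommRing C] (φ : A →+* B) (ψ : B →+* C) :
    jetAlgMap m (ψ.comp φ) = (jetAlgMap m ψ).comp (jetAlgMap m φ) := by
  refine Ideal.Quotient.ringHom_ext (RingHom.ext fun p => ?_)
  simp [jetAlgMap_mk, Polynomial.map_map]

/-- The `j`-th coefficient of an element of `A[t]/(t^(m+1))`, for `j ≤ m`. -/
noncomputable def coeff (j : Fin (m + 1)) (x : JetAlg A m) : A :=
  (Function.surjInv Ideal.Quotient.mk_surjective x : Polynomial A).coeff j

lemma coeff_mk (j : Fin (m + 1)) (p : Polynomial A) :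
    coeff j (Ideal.Quotient.mk _ p : JetAlg A m) = p.coeff j := by
  have h := Function.surjInv_eq (Ideal.Quotient.mk_surjective
    (I := Ideal.span {(Polynomial.X : Polynomial A) ^ (m + 1)})) (Ideal.Quotient.mk _ p)
  rw [Ideal.Quotient.eq, Ideal.mem_span_singleton, Polynomial.X_pow_dvd_iff] at h
  exact sub_eq_zero.mp ((Polynomial.coeff_sub _ _ _).symm.trans (h j j.2))

@[ext]
lemma ext_coeff {x y : JetAlg A m} (h : ∀ j, coeff j x = coeff j y) : x = y := by
  obtain ⟨p, rfl⟩ := Ideal.Quotient.mk_surjective x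
  obtain ⟨q, rfl⟩ := Ideal.Quotient.mk_surjective y
  rw [Ideal.Quotient.eq, Ideal.mem_span_singleton, Polynomial.X_pow_dvd_iff]
  intro d hd
  simpa [coeff_mk, sub_eq_zero] using h ⟨d, hd⟩

lemma coeff_zero (j : Fin (m + 1)) : coeff j (0 : JetAlg A m) = 0 := by
  simpa using coeff_mk (A := A) j 0

lemma coeff_jetAlgMap (φ : A →+* B) (j : Fin (m + 1)) (x : JetAlg A m) :
    coeff j (jetAlgMap m φ x) = φ (coeff j x) := by
  obtain ⟨p, rfl⟩ := Ideal.Quotient.mk_surjective x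
  simp [jetAlgMap_mk, coeff_mk]

/-- The element of `A[t]/(t^(m+1))` with prescribed coefficients. -/
noncomputable def ofCoeff (a : Fin (m + 1) → A) : JetAlg A m :=
  Ideal.Quotient.mk _ (∑ i : Fin (m + 1), Polynomial.monomial (i : ℕ) (a i))

lemma coeff_ofCoeff (a : Fin (m + 1) → A) (j : Fin (m + 1)) : coeff j (ofCoeff a) = a j := by
  rw [ofCoeff, coeff_mk]
  simp [Polynomial.coeff_monomial, Fin.val_inj]

variable (m) in
/-- Every finite type algebra `R` over `k` admits a finite type algebra of `m`-jets `Q`: ring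
homomorphisms out of `Q` are ring homomorphisms from `R` into truncated polynomial rings. -/
theorem exists_universal {k R : Type} [CommRing k] [CommRing R] (ρ : k →+* R)
    (hρ : ρ.FiniteType) :
    ∃ (Q : Type) (_ : CommRing Q) (i : k →+* Q) (u : R →+* JetAlg Q m),
      i.FiniteType ∧ u.comp ρ = (const Q m).comp i ∧
      ∀ (A : Type) [CommRing A] (ψ : k →+* A) (g : R →+* JetAlg A m),
        g.comp ρ = (const A m).comp ψ →
        ∃! φ : Q →+* A, φ.comp i = ψ ∧ (jetAlgMap m φ).comp u = g := by
  algebraize [ρ]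
  obtain ⟨n, π, hπ⟩ := Algebra.FiniteType.iff_quotient_mvPolynomial''.mp ‹Algebra.FiniteType k R›
  let P := MvPolynomial (Fin n × Fin (m + 1)) k
  let u₀ : MvPolynomial (Fin n) k →+* JetAlg P m :=
    MvPolynomial.eval₂Hom ((const P m).comp MvPolynomial.C)
      fun i => ofCoeff fun j => MvPolynomial.X (i, j)
  let I : Ideal P := Ideal.span {x | ∃ p j, π p = 0 ∧ x = coeff j (u₀ p)}
  let q : P →+* P ⧸ I := Ideal.Quotient.mk I
  have hq : ∀ p, π p = 0 → (jetAlgMap m q).comp u₀ p = 0 := by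
    intro p hp
    ext j
    rw [RingHom.comp_apply, coeff_jetAlgMap, coeff_zero]
    exact Ideal.Quotient.eq_zero_iff_mem.mpr (Ideal.subset_span ⟨p, j, hp, rfl⟩)
  let u : R →+* JetAlg (P ⧸ I) m :=
    RingHom.liftOfSurjective π.toRingHom hπ ⟨(jetAlgMap m q).comp u₀, fun p hp => hq p hp⟩
  have hu : u.comp π.toRingHom = (jetAlgMap m q).comp u₀ :=
    RingHom.liftOfRightInverse_comp _ _ _ _
  have hπC : π.toRingHom.comp MvPolynomial.C = ρ := RingHom.ext fun a => π.commutes a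
  have hu₀C : u₀.comp MvPolynomial.C = (const P m).comp MvPolynomial.C :=
    RingHom.ext fun a => by simp [u₀]
  refine ⟨P ⧸ I, inferInstance, q.comp MvPolynomial.C, u, ?_, ?_, ?_⟩
  · have : (algebraMap k (P ⧸ I)).FiniteType := by
      rw [RingHom.finiteType_algebraMap]
      infer_instance
    exact this
  · rw [← hπC, ← RingHom.comp_assoc, hu, RingHom.comp_assoc, hu₀C, ← RingHom.comp_assoc,
      jetAlgMap_comp_const, RingHom.comp_assoc]
  · intro A _ ψ g hg
    let φ₀ : P →+* A := MvPolynomial.eval₂Hom ψ fun ij => coeff ij.2 (g (π (MvPolynomial.X ij.1)))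
    have hC (a : k) : φ₀ (MvPolynomial.C a) = ψ a := MvPolynomial.eval₂Hom_C ..
    have hX (ij) : φ₀ (MvPolynomial.X ij) = coeff ij.2 (g (π (MvPolynomial.X ij.1))) :=
      MvPolynomial.eval₂Hom_X' ..
    have hφ₀ : (jetAlgMap m φ₀).comp u₀ = g.comp π.toRingHom := by
      refine MvPolynomial.ringHom_ext' ?_ fun i => ?_
      · rw [RingHom.comp_assoc, RingHom.comp_assoc, hπC, hg, hu₀C, ← RingHom.comp_assoc,
          jetAlgMap_comp_const, RingHom.comp_assoc]
        congr 1
        ext a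
        simp [hC]
      · ext j
        simp [u₀, coeff_jetAlgMap, coeff_ofCoeff, hX]
    have hI : ∀ x ∈ I, φ₀ x = 0 := by
      intro x hx
      refine (Ideal.span_le (I := RingHom.ker φ₀)).mpr ?_ hx
      rintro _ ⟨p, j, hp, rfl⟩
      have := congr(coeff j ($hφ₀ p))
      simp only [RingHom.comp_apply, coeff_jetAlgMap] at this
      simpa [hp, coeff_zero] using this
    refine ⟨Ideal.Quotient.lift I φ₀ hI, ⟨?_, ?_⟩, ?_⟩
    · ext a
      simp [q, hC]
    · refine (RingHom.cancel_right (f := π.toRingHom) hπ).mp ?_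
      rw [RingHom.comp_assoc, hu, ← RingHom.comp_assoc, ← jetAlgMap_comp, ← hφ₀]
      rfl
    · rintro φ ⟨h₁, h₂⟩
      refine Ideal.Quotient.ringHom_ext (MvPolynomial.ringHom_ext' ?_ fun ij => ?_)
      · ext a
        simpa [q, hC] using congr($h₁ a)
      · have := congr(coeff ij.2 ($h₂ (π (MvPolynomial.X ij.1))))
        have h₃ := congr($hu (MvPolynomial.X ij.1))
        simp only [RingHom.comp_apply, AlgHom.toRingHom_eq_coe, RingHom.coe_coe] at this h₃
        rw [h₃, coeff_jetAlgMap, coeff_jetAlgMap] at this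
        simpa [u₀, coeff_ofCoeff, hX, q] using this

end JetAlg

open Limits Opposite

/-- The spectrum of `ℤ[t]/(t^(m+1))`. -/
noncomputable abbrev fatPoint (m : ℕ) : Scheme.{0} := Spec (CommRingCat.of (JetAlg ℤ m))

/-- The base change of `S` along `Spec ℤ[t]/(t^(m+1)) ⟶ Spec ℤ`. -/
noncomputable def Thick (m : ℕ) (S : Scheme.{0}) : Scheme.{0} :=
  pullback (specZIsTerminal.from S) (specZIsTerminal.from (fatPoint m))

namespace Thick

variable {m : ℕ} {S S' S'' X B : Scheme.{0}}

/-- The projection of the thickening to the base. -/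
noncomputable def proj (m : ℕ) (S : Scheme.{0}) : Thick m S ⟶ S := pullback.fst _ _

/-- The projection of the thickening to the fat point. -/
noncomputable def toFatPoint (m : ℕ) (S : Scheme.{0}) : Thick m S ⟶ fatPoint m :=
  pullback.snd _ _

lemma hom_ext {f g : X ⟶ Thick m S} (h₁ : f ≫ proj m S = g ≫ proj m S)
    (h₂ : f ≫ toFatPoint m S = g ≫ toFatPoint m S) : f = g :=
  pullback.hom_ext h₁ h₂

/-- A morphism to the thickening from its two components. -/
noncomputable def lift (f : X ⟶ S) (g : X ⟶ fatPoint m) : X ⟶ Thick m S :=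
  pullback.lift f g (specZIsTerminal.hom_ext _ _)

@[simp]
lemma lift_proj (f : X ⟶ S) (g : X ⟶ fatPoint m) : lift f g ≫ proj m S = f :=
  pullback.lift_fst _ _ _

@[simp]
lemma lift_toFatPoint (f : X ⟶ S) (g : X ⟶ fatPoint m) : lift f g ≫ toFatPoint m S = g :=
  pullback.lift_snd _ _ _

/-- Functoriality of the thickening. -/
noncomputable def map (m : ℕ) (f : S' ⟶ S) : Thick m S' ⟶ Thick m S :=
  lift (proj m S' ≫ f) (toFatPoint m S')

lemma map_proj (f : S' ⟶ S) : map m f ≫ proj m S = proj m S' ≫ f := lift_proj _ _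

lemma map_toFatPoint (f : S' ⟶ S) : map m f ≫ toFatPoint m S = toFatPoint m S' :=
  lift_toFatPoint _ _

lemma map_id : map m (𝟙 S) = 𝟙 (Thick m S) := by
  apply hom_ext <;> simp [map_proj, map_toFatPoint]

lemma map_comp (f : S'' ⟶ S') (g : S' ⟶ S) : map m (f ≫ g) = map m f ≫ map m g := by
  apply hom_ext
  · rw [Category.assoc, map_proj, map_proj, ← Category.assoc, ← Category.assoc, map_proj]
  · rw [Category.assoc, map_toFatPoint, map_toFatPoint, map_toFatPoint]

lemma isPullback_toFatPoint (m : ℕ) (S : Scheme.{0}) :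
    IsPullback (toFatPoint m S) (proj m S) (specZIsTerminal.from (fatPoint m))
      (specZIsTerminal.from S) :=
  (IsPullback.of_hasPullback _ _).flip

lemma isPullback_map (f : S' ⟶ S) : IsPullback (map m f) (proj m S') (proj m S) f := by
  refine .of_right ?_ (map_proj f) (isPullback_toFatPoint m S)
  rw [map_toFatPoint, specZIsTerminal.hom_ext (f ≫ _) (specZIsTerminal.from S')]
  exact isPullback_toFatPoint m S'

lemma exists_lift_pullback (f : S' ⟶ S) (g : S'' ⟶ S) (p : X ⟶ Thick m S') (q : X ⟶ Thick m S'')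
    (h : p ≫ map m f = q ≫ map m g) :
    ∃ w : X ⟶ Thick m (pullback f g),
      w ≫ map m (pullback.fst f g) = p ∧ w ≫ map m (pullback.snd f g) = q := by
  have h₁ : (p ≫ proj m S') ≫ f = (q ≫ proj m S'') ≫ g := by
    rw [Category.assoc, Category.assoc, ← map_proj, ← map_proj, ← Category.assoc, h,
      Category.assoc]
  have h₂ : p ≫ toFatPoint m S' = q ≫ toFatPoint m S'' := by
    rw [← map_toFatPoint f, ← map_toFatPoint g, ← Category.assoc, h, Category.assoc]
  refine ⟨lift (pullback.lift _ _ h₁) (p ≫ toFatPoint m S'), ?_, ?_⟩ <;> apply hom_ext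
  · rw [Category.assoc, map_proj, ← Category.assoc, lift_proj, pullback.lift_fst]
  · rw [Category.assoc, map_toFatPoint, lift_toFatPoint]
  · rw [Category.assoc, map_proj, ← Category.assoc, lift_proj, pullback.lift_snd]
  · rw [Category.assoc, map_toFatPoint, lift_toFatPoint, h₂]

instance (f : S' ⟶ S) [IsOpenImmersion f] : IsOpenImmersion (map m f) :=
  MorphismProperty.of_isPullback (P := @IsOpenImmersion) (isPullback_map f).flip ‹_›

/-- The thickening of an open cover. -/
noncomputable def cover (m : ℕ) (𝒰 : S.OpenCover) : (Thick m S).OpenCover :=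
  Scheme.Cover.copy (𝒰.pullback₁ (proj m S)) 𝒰.I₀ (fun i => Thick m (𝒰.X i)) (fun i => map m (𝒰.f i))
    (Equiv.refl _) (fun i => (isPullback_map (𝒰.f i)).isoPullback)
    (fun i => ((isPullback_map (𝒰.f i)).isoPullback_hom_fst).symm)

/-- Evaluation of a truncated polynomial at `t = 0`. -/
noncomputable def evalZero (m : ℕ) : JetAlg ℤ m →+* ℤ :=
  Ideal.Quotient.lift _ (Polynomial.evalRingHom 0) fun p hp => by
    obtain ⟨q, rfl⟩ := Ideal.mem_span_singleton.mp hp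
    simp

/-- The inclusion of the origin into the fat point. -/
noncomputable def origin (m : ℕ) : Spec (CommRingCat.of ℤ) ⟶ fatPoint m :=
  Spec.map (CommRingCat.ofHom (evalZero m))

/-- The zero section of the thickening. -/
noncomputable def zero (m : ℕ) (S : Scheme.{0}) : S ⟶ Thick m S :=
  lift (𝟙 S) (specZIsTerminal.from S ≫ origin m)

lemma zero_proj : zero m S ≫ proj m S = 𝟙 S := lift_proj _ _

lemma zero_map (f : S' ⟶ S) : zero m S' ≫ map m f = f ≫ zero m S := by
  apply hom_ext
  · rw [Category.assoc, map_proj, ← Category.assoc, zero_proj, Category.assoc, zero_proj]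
    simp
  · rw [Category.assoc, map_toFatPoint, zero, zero, lift_toFatPoint, Category.assoc,
      lift_toFatPoint, ← Category.assoc]
    congr 1
    exact specZIsTerminal.hom_ext _ _

lemma surjective_origin : Surjective (origin m) := by
  refine ⟨fun x => ?_⟩
  obtain ⟨y, hy⟩ : x ∈ Set.range (PrimeSpectrum.comap (evalZero m)) := by
    rw [range_comap_of_surjective]
    · intro a ha
      obtain ⟨p, rfl⟩ := Ideal.Quotient.mk_surjective a
      have hp : Polynomial.eval 0 p = 0 := ha
      rw [← Polynomial.coeff_zero_eq_eval_zero, ← Polynomial.X_dvd_iff] at hp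
      refine x.2.mem_of_pow_mem (m + 1) ?_
      rw [← map_pow, Ideal.Quotient.eq_zero_iff_mem.mpr
        (Ideal.mem_span_singleton.mpr (pow_dvd_pow_of_dvd hp _))]
      exact zero_mem _
    · exact Ideal.Quotient.lift_surjective_of_surjective _ _ fun a => ⟨Polynomial.C a, by simp⟩
  exact ⟨y, hy⟩

instance : Surjective (zero m S) := by
  have : IsPullback (zero m S) (specZIsTerminal.from S) (toFatPoint m S) (origin m) := by
    refine .of_right ?_ (lift_toFatPoint _ _) (isPullback_toFatPoint m S).flip
    rw [zero_proj, specZIsTerminal.hom_ext (origin m ≫ _) (𝟙 _)]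
    exact .of_horiz_isIso ⟨by simp⟩
  exact MorphismProperty.of_isPullback (P := @Surjective) this.flip surjective_origin

/-- The comparison of `Spec A[t]/(t^(m+1))` with the thickening of `Spec A`. -/
noncomputable def affine (m : ℕ) (A : Type) [CommRing A] :
    Spec (CommRingCat.of (JetAlg A m)) ⟶ Thick m (Spec (CommRingCat.of A)) :=
  lift (Spec.map (CommRingCat.ofHom (JetAlg.const A m)))
    (Spec.map (CommRingCat.ofHom (jetAlgMap m (Int.castRingHom A))))

lemma affine_proj (A : Type) [CommRing A] :
    affine m A ≫ proj m _ = Spec.map (CommRingCat.ofHom (JetAlg.const A m)) := lift_proj _ _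

lemma affine_toFatPoint (A : Type) [CommRing A] :
    affine m A ≫ toFatPoint m _ =
      Spec.map (CommRingCat.ofHom (jetAlgMap m (Int.castRingHom A))) := lift_toFatPoint _ _

lemma affine_map {A B : Type} [CommRing A] [CommRing B] (φ : A →+* B) :
    affine m B ≫ map m (Spec.map (CommRingCat.ofHom φ)) =
      Spec.map (CommRingCat.ofHom (jetAlgMap m φ)) ≫ affine m A := by
  apply hom_ext
  · rw [Category.assoc, map_proj, ← Category.assoc, affine_proj, Category.assoc, affine_proj,
      ← Spec.map_comp, ← Spec.map_comp, ← CommRingCat.ofHom_comp, ← CommRingCat.ofHom_comp,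
      JetAlg.jetAlgMap_comp_const]
  · rw [Category.assoc, map_toFatPoint, affine_toFatPoint, Category.assoc, affine_toFatPoint,
      ← Spec.map_comp, ← CommRingCat.ofHom_comp, ← JetAlg.jetAlgMap_comp]
    congr 3
    exact RingHom.ext_int _ _

lemma isPushout_const (A : Type) [CommRing A] :
    IsPushout (CommRingCat.ofHom (Int.castRingHom A)) (CommRingCat.ofHom (JetAlg.const ℤ m))
      (CommRingCat.ofHom (JetAlg.const A m))
      (CommRingCat.ofHom (jetAlgMap m (Int.castRingHom A))) := by
  refine ⟨⟨?_⟩, ⟨PushoutCocone.IsColimit.mk _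
    (fun c => CommRingCat.ofHom (Ideal.Quotient.lift _
      (Polynomial.eval₂RingHom c.inl.hom (c.inr.hom (Ideal.Quotient.mk _ Polynomial.X)))
      fun p hp => ?_)) ?_ ?_ ?_⟩⟩
  · exact CommRingCat.hom_ext (RingHom.ext_int _ _)
  · obtain ⟨q, rfl⟩ := Ideal.mem_span_singleton.mp hp
    simp only [map_mul, map_pow, Polynomial.coe_eval₂RingHom, Polynomial.eval₂_X]
    rw [← map_pow, ← map_pow, Ideal.Quotient.eq_zero_iff_mem.mpr
      (Ideal.mem_span_singleton_self _), map_zero, zero_mul]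
  · intro c
    ext a
    simp [JetAlg.const]
  · intro c
    refine CommRingCat.hom_ext (Ideal.Quotient.ringHom_ext (Polynomial.ringHom_ext' ?_ ?_))
    · exact RingHom.ext_int _ _
    · simp [JetAlg.jetAlgMap_mk]
  · intro c f h₁ h₂
    refine CommRingCat.hom_ext (Ideal.Quotient.ringHom_ext (Polynomial.ringHom_ext ?_ ?_))
    · intro a
      simpa [JetAlg.const] using congr($h₁ a)
    · have := congr($h₂ (Ideal.Quotient.mk _ Polynomial.X))
      simpa [JetAlg.jetAlgMap_mk] using this

instance (A : Type) [CommRing A] : IsIso (affine m A) := by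
  have h := isPullback_SpecMap_of_isPushout _ _ _ _ (isPushout_const (m := m) A)
  have h' : IsPullback (toFatPoint m (Spec (CommRingCat.of A))) (proj m _)
      (Spec.map (CommRingCat.ofHom (JetAlg.const ℤ m)))
      (Spec.map (CommRingCat.ofHom (Int.castRingHom A))) := by
    convert isPullback_toFatPoint m _ using 1
    · exact specZIsTerminal.hom_ext _ _
    · exact specZIsTerminal.hom_ext _ _
  have : affine m A = (h.isoIsPullback _ _ h'.flip).hom := by
    apply hom_ext <;> simp [affine_proj, affine_toFatPoint]
  rw [this]
  infer_instance

end Thick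

/-- A morphism `S ⟶ B` together with an `m`-jet of `X` over it, for `s : X ⟶ B`. -/
@[ext]
structure Jet (m : ℕ) {X B : Scheme.{0}} (s : X ⟶ B) (S : Scheme.{0}) where
  /-- The structure morphism to the base. -/
  base : S ⟶ B
  /-- The morphism from the thickening. -/
  hom : Thick m S ⟶ X
  w : hom ≫ s = Thick.proj m S ≫ base

namespace Jet

variable {m : ℕ} {X U B : Scheme.{0}} {s : X ⟶ B} {S S' S'' : Scheme.{0}}

/-- The restriction of a jet along a morphism. -/
@[simps]
noncomputable def pull (x : Jet m s S) (f : S' ⟶ S) : Jet m s S' where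
  base := f ≫ x.base
  hom := Thick.map m f ≫ x.hom
  w := by
    rw [Category.assoc, x.w, ← Category.assoc, Thick.map_proj, Category.assoc]

@[simp]
lemma pull_id (x : Jet m s S) : x.pull (𝟙 S) = x := by
  ext1 <;> simp [Thick.map_id]

lemma pull_comp (x : Jet m s S) (f : S' ⟶ S) (g : S'' ⟶ S') :
    x.pull (g ≫ f) = (x.pull f).pull g := by
  ext1 <;> simp [Thick.map_comp]

/-- The image of a jet under a morphism. -/
@[simps]
noncomputable def push (j : U ⟶ X) (x : Jet m (j ≫ s) S) : Jet m s S where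
  base := x.base
  hom := x.hom ≫ j
  w := by rw [Category.assoc, x.w]

lemma push_pull (j : U ⟶ X) (x : Jet m (j ≫ s) S) (f : S' ⟶ S) :
    push j (x.pull f) = (push j x).pull f := by
  ext1 <;> simp

lemma push_injective (j : U ⟶ X) [Mono j] :
    Function.Injective (push j : Jet m (j ≫ s) S → Jet m s S) := by
  intro x y h
  ext1
  · exact congr(($h).base)
  · exact (cancel_mono j).mp congr(($h).hom)

lemma ext_cover (𝒰 : S.OpenCover) {x y : Jet m s S}
    (h : ∀ i, x.pull (𝒰.f i) = y.pull (𝒰.f i)) : x = y := by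
  ext1
  · exact 𝒰.hom_ext _ _ fun i => congr(($(h i)).base)
  · exact (Thick.cover m 𝒰).hom_ext _ _ fun i => congr(($(h i)).hom)

lemma exists_glue (𝒰 : S.OpenCover) (x : ∀ i, Jet m s (𝒰.X i))
    (h : ∀ i j, (x i).pull (pullback.fst (𝒰.f i) (𝒰.f j)) =
      (x j).pull (pullback.snd (𝒰.f i) (𝒰.f j))) :
    ∃ y : Jet m s S, ∀ i, y.pull (𝒰.f i) = x i := by
  let b : S ⟶ B := 𝒰.glueMorphisms (fun i => (x i).base) fun i j => congr(($(h i j)).base)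
  let g : Thick m S ⟶ X := (Thick.cover m 𝒰).glueMorphisms (fun i => (x i).hom) fun i j => by
    let p := pullback.fst (Thick.map m (𝒰.f i)) (Thick.map m (𝒰.f j))
    let q := pullback.snd (Thick.map m (𝒰.f i)) (Thick.map m (𝒰.f j))
    have hpq : p ≫ Thick.map m (𝒰.f i) = q ≫ Thick.map m (𝒰.f j) := pullback.condition
    obtain ⟨w, hw₁, hw₂⟩ := Thick.exists_lift_pullback _ _ _ _ hpq
    change p ≫ _ = q ≫ _
    have := congr(w ≫ ($(h i j)).hom)
    simpa [← hw₁, ← hw₂] using this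
  have hb (i) : 𝒰.f i ≫ b = (x i).base := 𝒰.ι_glueMorphisms _ _ i
  have hg (i) : Thick.map m (𝒰.f i) ≫ g = (x i).hom := (Thick.cover m 𝒰).ι_glueMorphisms _ _ i
  refine ⟨⟨b, g, (Thick.cover m 𝒰).hom_ext _ _ fun (i : 𝒰.I₀) => ?_⟩, fun i => ?_⟩
  · change Thick.map m (𝒰.f i) ≫ _ = Thick.map m (𝒰.f i) ≫ _
    rw [← Category.assoc, hg, (x i).w, ← Category.assoc, Thick.map_proj, Category.assoc, hb]
  · ext1
    · exact hb i
    · exact hg i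

lemma existsUnique_of_affine {J : Scheme.{0}} (u : Jet m s J)
    (h : ∀ (A : CommRingCat.{0}) (x : Jet m s (Spec A)), ∃! f : Spec A ⟶ J, u.pull f = x)
    (S : Scheme.{0}) (x : Jet m s S) : ∃! f : S ⟶ J, u.pull f = x := by
  have hcov (S : Scheme.{0}) :
      ∃ 𝒰 : S.OpenCover, ∀ i (x : Jet m s (𝒰.X i)), ∃! f : 𝒰.X i ⟶ J, u.pull f = x :=
    ⟨S.affineCover, fun i => h _⟩
  have hinj {S : Scheme.{0}} (f g : S ⟶ J) (h : u.pull f = u.pull g) : f = g := by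
    obtain ⟨𝒰, h𝒰⟩ := hcov S
    exact 𝒰.hom_ext _ _ fun i => (h𝒰 i _).unique rfl (by rw [pull_comp, pull_comp, h])
  obtain ⟨𝒰, h𝒰⟩ := hcov S
  choose f hf using fun i => (h𝒰 i (x.pull (𝒰.f i))).exists
  have H : ∃ g : S ⟶ J, u.pull g = x := by
    refine ⟨𝒰.glueMorphisms f fun i j => hinj _ _ ?_, ext_cover 𝒰 fun i => ?_⟩
    · rw [pull_comp, pull_comp, hf, hf, ← pull_comp, ← pull_comp, pullback.condition]
    · rw [← pull_comp, 𝒰.ι_glueMorphisms, hf]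
  exact existsUnique_of_exists_of_unique H fun g g' hg hg' => hinj _ _ (hg.trans hg'.symm)

section Affine

variable {k R A A' : Type} [CommRing k] [CommRing R] [CommRing A] [CommRing A']
  {ρ : k →+* R}

/-- The jet over `Spec A` given by ring homomorphisms. -/
@[simps]
noncomputable def ofRingHom (ψ : k →+* A) (g : R →+* JetAlg A m)
    (h : g.comp ρ = (JetAlg.const A m).comp ψ) :
    Jet m (Spec.map (CommRingCat.ofHom ρ)) (Spec (CommRingCat.of A)) where
  base := Spec.map (CommRingCat.ofHom ψ)
  hom := inv (Thick.affine m A) ≫ Spec.map (CommRingCat.ofHom g)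
  w := by
    rw [Category.assoc, IsIso.inv_comp_eq, ← Category.assoc, Thick.affine_proj,
      ← Spec.map_comp, ← Spec.map_comp, ← CommRingCat.ofHom_comp, ← CommRingCat.ofHom_comp, h]

lemma ofRingHom_pull (ψ : k →+* A) (g : R →+* JetAlg A m)
    (h : g.comp ρ = (JetAlg.const A m).comp ψ) (φ : A →+* A') :
    (ofRingHom ψ g h).pull (Spec.map (CommRingCat.ofHom φ)) =
      ofRingHom (φ.comp ψ) ((jetAlgMap m φ).comp g) (by
        rw [RingHom.comp_assoc, h, ← RingHom.comp_assoc, JetAlg.jetAlgMap_comp_const,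
          RingHom.comp_assoc]) := by
  ext1
  · simp
  · have := Thick.affine_map (m := m) φ
    simp only [pull_hom, ofRingHom_hom, CommRingCat.ofHom_comp, Spec.map_comp]
    rw [← Category.assoc, ← Category.assoc]
    congr 1
    rw [IsIso.comp_inv_eq, Category.assoc, ← this, IsIso.inv_hom_id_assoc]

lemma ofRingHom_inj {ψ ψ' : k →+* A} {g g' : R →+* JetAlg A m}
    {h : g.comp ρ = (JetAlg.const A m).comp ψ} {h' : g'.comp ρ = (JetAlg.const A m).comp ψ'} :
    ofRingHom ψ g h = ofRingHom ψ' g' h' ↔ ψ = ψ' ∧ g = g' := by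
  rw [Jet.ext_iff]
  refine and_congr ?_ ?_
  · exact ⟨fun e => congr(($(Spec.map_injective e)).hom), fun e => by subst e; rfl⟩
  · refine ⟨fun e => congr(($(Spec.map_injective ((cancel_epi _).mp e))).hom), fun e => by
      subst e; rfl⟩

lemma exists_eq_ofRingHom
    (x : Jet m (Spec.map (CommRingCat.ofHom ρ)) (Spec (CommRingCat.of A))) :
    ∃ ψ g h, x = ofRingHom ψ g h := by
  obtain ⟨ψ, hψ⟩ := Spec.map_surjective x.base
  obtain ⟨g, hg⟩ := Spec.map_surjective (Thick.affine m A ≫ x.hom)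
  refine ⟨ψ.hom, g.hom, ?_, ?_⟩
  · have := congr(Thick.affine m A ≫ $(x.w))
    rw [← Category.assoc, ← Category.assoc, ← hg, ← hψ, Thick.affine_proj, ← Spec.map_comp,
      ← Spec.map_comp] at this
    exact congr(($(Spec.map_injective this)).hom)
  · ext1
    · exact hψ.symm
    · exact (IsIso.eq_inv_comp _).mpr hg.symm

end Affine

lemma exists_affine_universal (m : ℕ) {k R : CommRingCat.{0}} (s : Spec R ⟶ Spec k)
    [LocallyOfFiniteType s] :
    ∃ (J : Scheme.{0}) (u : Jet m s J), CompactSpace J ∧ LocallyOfFiniteType u.base ∧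
      ∀ (S : Scheme.{0}) (x : Jet m s S), ∃! f : S ⟶ J, u.pull f = x := by
  obtain ⟨⟨ρ⟩, rfl⟩ := Spec.map_surjective s
  have hρ : ρ.FiniteType :=
    (HasRingHomProperty.Spec_iff (P := @LocallyOfFiniteType)).mp ‹_›
  obtain ⟨Q, _, i, u, hi, hu, H⟩ := JetAlg.exists_universal m ρ hρ
  let U : Jet m (Spec.map (CommRingCat.ofHom ρ)) (Spec (CommRingCat.of Q)) := ofRingHom i u hu
  have hU (A : CommRingCat.{0}) (x : Jet m (Spec.map (CommRingCat.ofHom ρ)) (Spec A)) :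
      ∃! f : Spec A ⟶ Spec (CommRingCat.of Q), U.pull f = x := by
    obtain ⟨ψ, g, h, rfl⟩ := exists_eq_ofRingHom (A := A) x
    obtain ⟨φ, ⟨h₁, h₂⟩, h₃⟩ := H A ψ g h
    refine ⟨Spec.map (CommRingCat.ofHom φ), ?_, ?_⟩
    · exact (ofRingHom_pull _ _ _ _).trans (ofRingHom_inj.mpr ⟨h₁, h₂⟩)
    · intro f hf
      obtain ⟨⟨φ'⟩, rfl⟩ := Spec.map_surjective f
      have := h₃ φ' (ofRingHom_inj.mp ((ofRingHom_pull i u hu φ').symm.trans hf))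
      rw [this]
      rfl
  exact ⟨_, U, inferInstance, (HasRingHomProperty.Spec_iff (P := @LocallyOfFiniteType)).mpr hi,
    existsUnique_of_affine U hU⟩

end Jet

/-- The functor of `m`-jets. -/
noncomputable def jetFunctor (m : ℕ) {X B : Scheme.{0}} (s : X ⟶ B) : Scheme.{0}ᵒᵖ ⥤ Type where
  obj S := Jet m s S.unop
  map f := ↾ fun x => x.pull f.unop
  map_id S := by
    exact ConcreteCategory.hom_ext _ _ fun x => x.pull_id
  map_comp f g := by
    exact ConcreteCategory.hom_ext _ _ fun x => x.pull_comp _ _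

namespace Jet

variable {m : ℕ} {X U B : Scheme.{0}} {s : X ⟶ B} {S S' S'' J : Scheme.{0}}

lemma isSheaf_jetFunctor (m : ℕ) {X B : Scheme.{0}} (s : X ⟶ B) :
    Presieve.IsSheaf Scheme.zariskiTopology (jetFunctor m s) := by
  rw [Scheme.zariskiTopology, Scheme.grothendieckTopology,
    Precoverage.isSheaf_toGrothendieck_iff_of_isStableUnderBaseChange]
  rintro Y S hS x hx
  obtain ⟨(𝓤 : Y.OpenCover), rfl⟩ := Scheme.exists_cover_of_mem_pretopology hS
  obtain ⟨y, hy⟩ := exists_glue 𝓤 (fun j => x (𝓤.f j) (.mk j)) fun i j =>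
    hx _ _ _ _ pullback.condition
  refine ⟨y, ?_, ?_⟩
  · rintro Z e ⟨j⟩
    exact hy j
  · intro e' h
    exact ext_cover 𝓤 fun j => (h (𝓤.f j) (.mk j)).trans (hy j).symm

/-- The morphism from a representable presheaf given by a jet. -/
noncomputable def toFunctor (x : Jet m s S) : yoneda.obj S ⟶ jetFunctor m s where
  app T := ↾ fun f => x.pull f
  naturality T T' f := by
    exact ConcreteCategory.hom_ext _ _ fun g => x.pull_comp _ _

lemma exists_eq_toFunctor (g : yoneda.obj S ⟶ jetFunctor m s) : ∃ x, g = toFunctor x := by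
  refine ⟨yonedaEquiv g, yonedaEquiv.injective ?_⟩
  exact (pull_id _).symm

/-- The locus of the base over which a jet is centered in `U`. -/
noncomputable def locus (j : U ⟶ X) [IsOpenImmersion j] (x : Jet m s S) : S.Opens :=
  (Thick.zero m S ≫ x.hom) ⁻¹ᵁ j.opensRange

lemma exists_push_eq_pull_locus (j : U ⟶ X) [IsOpenImmersion j] (x : Jet m s S) :
    ∃ y : Jet m (j ≫ s) (locus j x), push j y = x.pull (locus j x).ι := by
  have h : Set.range (Thick.map m (locus j x).ι ≫ x.hom) ⊆ Set.range j := by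
    rintro _ ⟨y, rfl⟩
    obtain ⟨v, rfl⟩ := (Thick.zero m (locus j x).toScheme).surjective y
    have h₁ : Thick.zero m (locus j x).toScheme ≫ Thick.map m (locus j x).ι ≫ x.hom =
        (locus j x).ι ≫ Thick.zero m S ≫ x.hom := by
      rw [← Category.assoc, Thick.zero_map, Category.assoc]
    rw [← Scheme.Hom.comp_apply, h₁]
    exact v.2
  refine ⟨⟨(locus j x).ι ≫ x.base, IsOpenImmersion.lift j _ h, ?_⟩, ?_⟩
  · rw [← Category.assoc, IsOpenImmersion.lift_fac]
    exact (x.pull (locus j x).ι).w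
  · ext1
    · rfl
    · exact IsOpenImmersion.lift_fac _ _ _

lemma range_subset_locus (j : U ⟶ X) [IsOpenImmersion j] (x : Jet m s S) (f : S' ⟶ S)
    (y : Jet m (j ≫ s) S') (h : push j y = x.pull f) : Set.range f ⊆ Set.range (locus j x).ι := by
  rintro _ ⟨t, rfl⟩
  have h₁ : f ≫ Thick.zero m S ≫ x.hom = Thick.zero m S' ≫ y.hom ≫ j := by
    rw [← Category.assoc, ← Thick.zero_map, Category.assoc]
    exact congr(_ ≫ ($h).hom).symm
  rw [Scheme.Opens.range_ι]
  exact ⟨_, congr(($h₁) t).symm⟩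

lemma isPullback_toFunctor (j : U ⟶ X) [IsOpenImmersion j] {u : Jet m (j ≫ s) J}
    (hu : ∀ (S : Scheme.{0}) (x : Jet m (j ≫ s) S), ∃! f : S ⟶ J, u.pull f = x)
    (x : Jet m s S) : ∃ f : (locus j x).toScheme ⟶ J,
      IsPullback (yoneda.map f) (yoneda.map (locus j x).ι) (push j u).toFunctor x.toFunctor := by
  obtain ⟨y, hy⟩ := exists_push_eq_pull_locus j x
  obtain ⟨f, hf, -⟩ := hu _ y
  have w : (push j u).pull f = x.pull (locus j x).ι := by rw [← push_pull, hf, hy]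
  refine ⟨f, .of_forall_isPullback_app fun T => ?_⟩
  rw [Types.isPullback_iff]
  refine ⟨?_, ?_, ?_⟩
  · refine ConcreteCategory.hom_ext _ _ fun a => ?_
    change (push j u).pull (a ≫ f) = x.pull (a ≫ _)
    rw [pull_comp, pull_comp, w]
  · rintro a b ⟨-, h⟩
    exact (cancel_mono (locus j x).ι).mp h
  · intro a b h
    change (push j u).pull a = x.pull b at h
    rw [← push_pull] at h
    have hb : IsOpenImmersion.lift (locus j x).ι b (range_subset_locus j x b _ h) ≫ _ = b :=
      IsOpenImmersion.lift_fac _ _ _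
    refine ⟨IsOpenImmersion.lift (locus j x).ι b (range_subset_locus j x b _ h), ?_, hb⟩
    refine (hu _ _).unique (push_injective j ?_) rfl
    rw [h]
    change push j (u.pull (_ ≫ f)) = _
    rw [push_pull, pull_comp, w, ← pull_comp, hb]

lemma presheaf_toFunctor (j : U ⟶ X) [IsOpenImmersion j] {u : Jet m (j ≫ s) J}
    (hu : ∀ (S : Scheme.{0}) (x : Jet m (j ≫ s) S), ∃! f : S ⟶ J, u.pull f = x) :
    IsOpenImmersion.presheaf (push j u).toFunctor := by
  refine MorphismProperty.relative.of_exists fun S g => ?_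
  obtain ⟨x, rfl⟩ := exists_eq_toFunctor g
  obtain ⟨f, hf⟩ := isPullback_toFunctor j hu x
  exact ⟨_, yoneda.map f, (locus j x).ι, hf, inferInstance⟩

lemma isLocallySurjective_desc {ι : Type} {U J : ι → Scheme.{0}} (j : ∀ i, U i ⟶ X)
    [∀ i, IsOpenImmersion (j i)] (hj : ∀ p : X, ∃ i, p ∈ Set.range (j i))
    (u : ∀ i, Jet m (j i ≫ s) (J i))
    (hu : ∀ i (S : Scheme.{0}) (x : Jet m (j i ≫ s) S), ∃! f : S ⟶ J i, (u i).pull f = x) :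
    Presheaf.IsLocallySurjective Scheme.zariskiTopology
      (Sigma.desc fun i => (push (j i) (u i)).toFunctor) where
  imageSieve_mem {S} x := by
    change Jet m s S at x
    let 𝒰 : S.OpenCover := S.openCoverOfIsOpenCover (fun i => locus (j i) x) <| by
      refine .mk (top_unique fun p _ => ?_)
      obtain ⟨i, hi⟩ := hj (x.hom (Thick.zero m S p))
      exact TopologicalSpace.Opens.mem_iSup.mpr ⟨i, hi⟩
    have h𝒰 (i : ι) : Presheaf.imageSieve
        (Sigma.desc fun i => (push (j i) (u i)).toFunctor) x (locus (j i) x).ι := by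
      obtain ⟨f, hf⟩ := isPullback_toFunctor (j i) (hu i) x
      refine ⟨(Sigma.ι (fun i => yoneda.obj (J i)) i).app _ f, ?_⟩
      rw [← NatTrans.comp_app_apply, Sigma.ι_desc]
      have := NatTrans.congr_app hf.w (op (locus (j i) x).toScheme)
      have := ConcreteCategory.congr_hom this (𝟙 (locus (j i) x).toScheme)
      simpa using! this
    refine GrothendieckTopology.superset_covering _ ?_ 𝒰.mem_grothendieckTopology
    rintro V _ ⟨W, a, _, ⟨(i : ι)⟩, rfl⟩
    exact Sieve.downward_closed _ (h𝒰 i) _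

theorem exists_universal (m : ℕ) {X : Scheme.{0}} [CompactSpace X] {k : CommRingCat.{0}}
    (s : X ⟶ Spec k) [LocallyOfFiniteType s] :
    ∃ (J : Scheme.{0}) (u : Jet m s J), CompactSpace J ∧ LocallyOfFiniteType u.base ∧
      ∀ (S : Scheme.{0}) (x : Jet m s S), ∃! f : S ⟶ J, u.pull f = x := by
  let 𝒰 : X.OpenCover := X.affineCover.finiteSubcover
  have (i : 𝒰.I₀) : LocallyOfFiniteType (𝒰.f i ≫ s) := by
    infer_instance
  have h𝒰 (i : 𝒰.I₀) : ∃ (J : Scheme.{0}) (u : Jet m (𝒰.f i ≫ s) J), CompactSpace J ∧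
      LocallyOfFiniteType u.base ∧
      ∀ (S : Scheme.{0}) (x : Jet m (𝒰.f i ≫ s) S), ∃! f : S ⟶ J, u.pull f = x := by
    have H {Y : Scheme.{0}} (R : CommRingCat.{0}) (h : Y = Spec R) (t : Y ⟶ Spec k)
        [LocallyOfFiniteType t] : ∃ (J : Scheme.{0}) (u : Jet m t J), CompactSpace J ∧
          LocallyOfFiniteType u.base ∧
          ∀ (S : Scheme.{0}) (x : Jet m t S), ∃! f : S ⟶ J, u.pull f = x := by
      subst h
      exact exists_affine_universal m t
    exact H (Y := 𝒰.X i) _ rfl (𝒰.f i ≫ s)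
  choose J u hJ hfin hu using h𝒰
  let F : Sheaf Scheme.zariskiTopology.{0} Type :=
    ⟨jetFunctor m s, (isSheaf_iff_isSheaf_of_type _ _).mpr (isSheaf_jetFunctor m s)⟩
  let f (i : 𝒰.I₀) : yoneda.obj (J i) ⟶ F.1 := (push (𝒰.f i) (u i)).toFunctor
  have hf (i : 𝒰.I₀) : IsOpenImmersion.presheaf (f i) := presheaf_toFunctor _ (hu i)
  have : Presheaf.IsLocallySurjective Scheme.zariskiTopology (Sigma.desc f) :=
    isLocallySurjective_desc _ 𝒰.exists_eq u hu
  let R := Scheme.LocalRepresentability.representableBy hf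
  let v : Jet m s _ := R.homEquiv (𝟙 _)
  have hv {S : Scheme.{0}} (g : S ⟶ _) : R.homEquiv g = v.pull g := R.homEquiv_eq g
  have hi (i) : v.pull (Scheme.LocalRepresentability.toGlued hf i) = push (𝒰.f i) (u i) := by
    rw [← hv]
    trans yonedaEquiv (f i)
    · exact Scheme.LocalRepresentability.yonedaGluedToSheaf_app_toGlued hf
    · exact pull_id _
  refine ⟨_, v, ?_, ?_, fun S x => ⟨R.homEquiv.symm x, ?_, fun g hg => ?_⟩⟩
  · have (i : (Scheme.LocalRepresentability.glueData hf).openCover.I₀) :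
        CompactSpace ((Scheme.LocalRepresentability.glueData hf).openCover.X i) := hJ i
    have : Finite (Scheme.LocalRepresentability.glueData hf).openCover.I₀ :=
      inferInstanceAs (Finite 𝒰.I₀)
    exact (Scheme.LocalRepresentability.glueData hf).openCover.compactSpace
  · have : IsZariskiLocalAtSource @LocallyOfFiniteType.{0} :=
      HasRingHomProperty.instIsZariskiLocalAtSource
    rw [IsZariskiLocalAtSource.iff_of_openCover (P := @LocallyOfFiniteType.{0})
      (𝒰 := (Scheme.LocalRepresentability.glueData hf).openCover)]
    intro i
    have h : Scheme.LocalRepresentability.toGlued hf i ≫ v.base = (u i).base :=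
      congr(($(hi i)).base)
    exact h ▸ hfin i
  · exact (hv _).symm.trans (R.homEquiv.apply_symm_apply x)
  · exact R.homEquiv.injective ((hv g).trans (hg.trans (R.homEquiv.apply_symm_apply x).symm))

end Jet

lemma JetAlg.const_comp_algebraMap (A : Type) [CommRing A] [Algebra ℂ A] (m : ℕ) :
    (JetAlg.const A m).comp (algebraMap ℂ A) = algebraMap ℂ (JetAlg A m) := rfl

/-- Points of a scheme representing jets correspond to jets. -/
noncomputable def Jet.equivCOver {m : ℕ} {X J : Scheme.{0}} {s : X ⟶ Spec (CommRingCat.of ℂ)}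
    (v : Jet m s J) (hv : ∀ (S : Scheme.{0}) (x : Jet m s S), ∃! f : S ⟶ J, v.pull f = x)
    (A : Type) [CommRing A] [Algebra ℂ A] : COver A J v.base ≃ COver (JetAlg A m) X s :=
  Equiv.ofBijective
    (fun u => ⟨Thick.affine m A ≫ (v.pull u.1).hom, by
      rw [Category.assoc, (v.pull u.1).w, Jet.pull_base, u.2, ← Category.assoc,
        Thick.affine_proj, ← Spec.map_comp, ← CommRingCat.ofHom_comp,
        JetAlg.const_comp_algebraMap]⟩) <| by
    refine ⟨fun u u' h => Subtype.ext ((hv _ _).unique rfl ?_), fun g => ?_⟩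
    · ext1
      · exact u'.2.trans u.2.symm
      · exact ((cancel_epi _).mp (congrArg Subtype.val h)).symm
    · obtain ⟨f, hf, -⟩ := hv _ ⟨Spec.map (CommRingCat.ofHom (algebraMap ℂ A)),
        inv (Thick.affine m A) ≫ g.1, by
          rw [Category.assoc, g.2, IsIso.inv_comp_eq, ← Category.assoc, Thick.affine_proj,
            ← Spec.map_comp, ← CommRingCat.ofHom_comp, JetAlg.const_comp_algebraMap]⟩
      refine ⟨⟨f, congr(($hf).base)⟩, Subtype.ext ?_⟩
      exact (congr(_ ≫ ($hf).hom)).trans (IsIso.hom_inv_id_assoc _ _)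

lemma Jet.equivCOver_apply {m : ℕ} {X J : Scheme.{0}} {s : X ⟶ Spec (CommRingCat.of ℂ)}
    (v : Jet m s J) (hv : ∀ (S : Scheme.{0}) (x : Jet m s S), ∃! f : S ⟶ J, v.pull f = x)
    (A : Type) [CommRing A] [Algebra ℂ A] (u : COver A J v.base) :
    (v.equivCOver hv A u).1 = Thick.affine m A ≫ Thick.map m u.1 ≫ v.hom := rfl

/-- **Existence of the scheme of `m`-jets.**
For `X` a scheme of finite type over `ℂ` and `m ∈ ℕ`, there is a scheme `J` of finite
type over `ℂ` together with bijections
`Hom_{Spec ℂ}(Spec A, J) ≃ Hom_{Spec ℂ}(Spec (A[t]/(t^(m+1))), X)`,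
natural in the commutative ℂ-algebra `A`. -/
theorem jet_scheme_exists (X : Scheme) (sX : X ⟶ Spec (CommRingCat.of ℂ))
    [LocallyOfFiniteType sX] [QuasiCompact sX] (m : ℕ) :
    ∃ (J : Scheme) (sJ : J ⟶ Spec (CommRingCat.of ℂ)),
      LocallyOfFiniteType sJ ∧ QuasiCompact sJ ∧
      ∃ e : ∀ (A : Type) [CommRing A] [Algebra ℂ A],
          COver A J sJ ≃ COver (JetAlg A m) X sX,
        ∀ (A B : Type) [CommRing A] [CommRing B] [Algebra ℂ A] [Algebra ℂ B]
          (φ : A →ₐ[ℂ] B) (u : COver A J sJ) (v : COver B J sJ),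
          v.1 = Spec.map (CommRingCat.ofHom (φ : A →+* B)) ≫ u.1 →
          (e B v).1 =
            Spec.map (CommRingCat.ofHom (jetAlgMap m (φ : A →+* B))) ≫ (e A u).1 := by
  have : CompactSpace X := QuasiCompact.compactSpace_of_compactSpace sX
  obtain ⟨J, v, hJ, hfin, hv⟩ := Jet.exists_universal m sX
  refine ⟨J, v.base, hfin, (quasiCompact_iff_compactSpace _).mpr hJ,
    fun A _ _ => v.equivCOver hv A, ?_⟩
  intro A B _ _ _ _ φ u v huv
  rw [Jet.equivCOver_apply, Jet.equivCOver_apply, huv, Thick.map_comp, Category.assoc,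
    ← Category.assoc, Thick.affine_map, Category.assoc]
end

section
/- Let n, k ≥ 1, and let b_1, …, b_n, g_1, …, g_k, h_1, …, h_k and c_{i,l} (1 ≤ i ≤ n, 1 ≤ l ≤ k) be polynomials in ℂ[x_1, …, x_n] satisfying b_i = Σ_{l=1}^k h_l·(∂g_l/∂x_i) + Σ_{l=1}^k c_{i,l}·g_l for every i (that is, V(g_1, …, g_k) is a solution of the 1-form ω = Σ_i b_i dx_i, meaning ω restricted to V(g_1,…,g_k) lies in the ideal generated by dg_1, …, dg_k). Then V(g_1, …, g_k) is strongly tangent to ω: for every m ∈ ℕ and every n-tuple a = (a_1, …, a_n) of formal power series in ℂ[[t]] such that t^{m+1} divides g_l(a_1, …, a_n) for every l, t^m divides Σ_{i=1}^n b_i(a_1, …, a_n)·a_i′. -/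
open PowerSeries

/-- The chain rule for a derivation applied to a polynomial evaluated at a tuple. -/
theorem Derivation.map_mvPolynomial_aeval {R A σ : Type*} [CommSemiring R] [CommSemiring A]
    [Algebra R A] [Fintype σ] (D : Derivation R A A) (a : σ → A) (p : MvPolynomial σ R) :
    D (MvPolynomial.aeval a p) =
      ∑ i, MvPolynomial.aeval a (MvPolynomial.pderiv i p) * D (a i) := by
  classical
  induction p using MvPolynomial.induction_on with
  | C r => simp
  | add p q hp hq => simp [hp, hq, add_mul, Finset.sum_add_distrib]
  | mul_X p j hp =>
    simp only [map_mul, MvPolynomial.aeval_X, Derivation.leibniz, hp, smul_eq_mul, map_add,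
      MvPolynomial.pderiv_X, add_mul, Finset.sum_add_distrib, Finset.mul_sum]
    congr 1
    · rw [Finset.sum_eq_single j] <;> simp +contextual [eq_comm]
    · simp only [mul_assoc]

/-- Differentiation lowers the order of vanishing at the origin by at most one. -/
theorem PowerSeries.X_pow_dvd_derivative {R : Type*} [CommSemiring R] {f : PowerSeries R} {m : ℕ}
    (hf : (X : PowerSeries R) ^ (m + 1) ∣ f) : (X : PowerSeries R) ^ m ∣ d⁄dX R f := by
  rw [X_pow_dvd_iff] at hf ⊢
  intro j hj
  rw [coeff_derivative, hf (j + 1) (by lia), zero_mul]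

/-- **Reduced solutions are strongly tangent.**
Suppose `b_i = ∑_l h_l ∂g_l/∂x_i + ∑_l c_{i,l} g_l`, i.e. `V(g_1,…,g_k)` is a solution
of the 1-form `ω = ∑ b_i dx_i`.  Then `V(g_1,…,g_k)` is strongly tangent to `ω`: every
`m`-jet of `V(g_1,…,g_k)` is an `m`-jet of the foliation. -/
theorem solution_strongly_tangent (n k : ℕ) (hn : 1 ≤ n) (hk : 1 ≤ k)
    (b : Fin n → MvPolynomial (Fin n) ℂ)
    (g h : Fin k → MvPolynomial (Fin n) ℂ)
    (c : Fin n → Fin k → MvPolynomial (Fin n) ℂ)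
    (hb : ∀ i, b i =
      (∑ l, h l * MvPolynomial.pderiv i (g l)) + ∑ l, c i l * g l)
    (m : ℕ) (a : Fin n → PowerSeries ℂ)
    (ha : ∀ l, (X : PowerSeries ℂ) ^ (m + 1) ∣ MvPolynomial.aeval a (g l)) :
    (X : PowerSeries ℂ) ^ m ∣
      ∑ i, MvPolynomial.aeval a (b i) * d⁄dX ℂ (a i) := by
  have key : ∑ i, MvPolynomial.aeval a (b i) * d⁄dX ℂ (a i) =
      (∑ l, MvPolynomial.aeval a (h l) * d⁄dX ℂ (MvPolynomial.aeval a (g l))) +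
        ∑ i, ∑ l, MvPolynomial.aeval a (c i l) * MvPolynomial.aeval a (g l) * d⁄dX ℂ (a i) := by
    simp only [hb, map_add, map_sum, map_mul, add_mul, Finset.sum_add_distrib, Finset.sum_mul,
      Derivation.map_mvPolynomial_aeval, Finset.mul_sum, mul_assoc]
    rw [Finset.sum_comm]
  rw [key]
  refine dvd_add (Finset.dvd_sum fun l _ => ?_)
    (Finset.dvd_sum fun i _ => Finset.dvd_sum fun l _ => ?_)
  · exact (X_pow_dvd_derivative (ha l)).mul_left _
  · exact (((pow_dvd_pow _ m.le_succ).trans (ha l)).mul_left _).mul_right _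
end

section
/- Let b_1, …, b_n, g_1, …, g_k and f be polynomials in ℂ[x_1, …, x_n]. Suppose V(g_1, …, g_k) is strongly tangent to the 1-form ω = Σ_i b_i dx_i, i.e. for every m ∈ ℕ and every n-tuple a of formal power series in ℂ[[t]] with t^{m+1} dividing g_l(a) for every l, t^m divides Σ_i b_i(a)·a_i′. Then V(f·g_1, …, f·g_k) is strongly tangent to the 1-form f·ω: for every m ∈ ℕ and every n-tuple a of formal power series in ℂ[[t]] with t^{m+1} dividing f(a)·g_l(a) for every l, t^m divides f(a)·Σ_i b_i(a)·a_i′. -/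
open PowerSeries

/-- **Strong tangency is preserved under multiplication by a function.**
If `V(g_1,…,g_k)` is strongly tangent to the 1-form `ω = ∑ b_i dx_i`, then
`V(f g_1, …, f g_k)` is strongly tangent to the 1-form `f·ω`. -/
theorem strongly_tangent_mul (n k : ℕ)
    (b : Fin n → MvPolynomial (Fin n) ℂ)
    (g : Fin k → MvPolynomial (Fin n) ℂ) (f : MvPolynomial (Fin n) ℂ)
    (hst : ∀ m : ℕ, ∀ a : Fin n → PowerSeries ℂ,
      (∀ l, (X : PowerSeries ℂ) ^ (m + 1) ∣ MvPolynomial.aeval a (g l)) →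
      (X : PowerSeries ℂ) ^ m ∣ ∑ i, MvPolynomial.aeval a (b i) * d⁄dX ℂ (a i))
    (m : ℕ) (a : Fin n → PowerSeries ℂ)
    (ha : ∀ l, (X : PowerSeries ℂ) ^ (m + 1) ∣
      MvPolynomial.aeval a f * MvPolynomial.aeval a (g l)) :
    (X : PowerSeries ℂ) ^ m ∣
      MvPolynomial.aeval a f * ∑ i, MvPolynomial.aeval a (b i) * d⁄dX ℂ (a i) := by
  by_cases hm : (X : PowerSeries ℂ) ^ m ∣ MvPolynomial.aeval a f
  · exact hm.mul_right _
  have hf : MvPolynomial.aeval a f ≠ 0 := fun h => hm (h ▸ dvd_zero _)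
  have hfin : FiniteMultiplicity (X : PowerSeries ℂ) (MvPolynomial.aeval a f) :=
    FiniteMultiplicity.of_not_isUnit X_prime.not_isUnit hf
  obtain ⟨u, hu, hXu⟩ := hfin.exists_eq_pow_mul_and_not_dvd
  set r := multiplicity (X : PowerSeries ℂ) (MvPolynomial.aeval a f)
  have hr : r ≤ m := by
    by_contra! h
    exact hm (hu ▸ (pow_dvd_pow X h.le).mul_right u)
  obtain ⟨d, rfl⟩ := Nat.exists_eq_add_of_le hr
  rw [hu, mul_assoc, pow_add]
  refine mul_dvd_mul_left _ ((hst d a fun l => ?_).mul_left u)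
  have h := ha l
  rw [hu, mul_assoc, add_assoc, pow_add,
    mul_dvd_mul_iff_left (pow_ne_zero r X_ne_zero)] at h
  exact X_prime.pow_dvd_of_dvd_mul_left _ hXu h
end
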